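/- Let P = ⟨x₁,…,x_m | r₁,…,rₙ⟩ be a finite presentation in which each relator rᵢ is a freely reduced and cyclically reduced word and the rᵢ are pairwise distinct, let k ≥ 12, and let P̄_t^k denote the group presented by P_t^k = ⟨x₁,…,x_m,t | (r₁t)^k,…,(rₙt)^k, t^k⟩. Then torlen(P̄_t^k) = torlen(P̄) + 1; precisely: tor₁(P̄_t^k) is nontrivial, and for every m ∈ ℕ, tor_{m+1}(P̄_t^k) = tor_{m+2}(P̄_t^k) if and only if tor_m(P̄) = tor_{m+1}(P̄). -/

import Mathlib

/-- A word on an alphabet `β`: a list of letters with exponents `±1`. -/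
abbrev Word (β : Type*) := List (β × Bool)

/-- A word is freely reduced if it has no subword `x x⁻¹` or `x⁻¹ x`. -/
def Reduced {β : Type*} (w : Word β) : Prop :=
  w.Chain' fun a b => a.1 = b.1 → a.2 = b.2

/-- A word is cyclically reduced if it is freely reduced and its first letter is not the
inverse of its last letter. -/
def CyclicallyReduced {β : Type*} (w : Word β) : Prop :=
  Reduced w ∧ ∀ a ∈ w.getLast?, ∀ b ∈ w.head?, a.1 = b.1 → a.2 = b.2

/-- The element of the free group on `x₁,…,x_m,t` given by the word `rᵢ` on the `x`'s. -/
def rho {m n : ℕ} (r : Fin n → Word (Fin m)) (i : Fin n) : FreeGroup (Fin m ⊕ Unit) :=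
  FreeGroup.mk ((r i).map fun l => (Sum.inl l.1, l.2))

/-- The generator `t` of the free group on `x₁,…,x_m,t`. -/
def tGen (m : ℕ) : FreeGroup (Fin m ⊕ Unit) := FreeGroup.of (Sum.inr ())

/-- The relator set `{(r₁t)^k, …, (rₙt)^k, t^k}` of the presentation
`P_t^k = ⟨x₁,…,x_m,t | (r₁t)^k,…,(rₙt)^k, t^k⟩`. -/
def PtkRels (m n k : ℕ) (r : Fin n → Word (Fin m)) : Set (FreeGroup (Fin m ⊕ Unit)) :=
  (Set.range fun i => (rho r i * tGen m) ^ k) ∪ {tGen m ^ k}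

/-- The relator set `{r₁, …, rₙ}` of the presentation `P = ⟨x₁,…,x_m | r₁,…,rₙ⟩`. -/
def PRels (m n : ℕ) (r : Fin n → Word (Fin m)) : Set (FreeGroup (Fin m)) :=
  Set.range fun i => FreeGroup.mk (r i)

/-- The ascending chain of normal subgroups `tor₀(G) = 1`,
`tor_{n+1}(G) = ⟪elements of finite order mod tor_n(G)⟫`. -/
def tor (G : Type*) [Group G] : ℕ → Subgroup G
  | 0 => ⊥
  | n + 1 => Subgroup.normalClosure {g : G | ∃ k : ℕ, 0 < k ∧ g ^ k ∈ tor G n}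

namespace Monoid.PushoutI

variable {ι : Type*} {G : ι → Type*} {H : Type*} [∀ i, Group (G i)] [Group H]
  {φ : ∀ i, H →* G i}

/-- A list of letters is alternating if adjacent letters come from different factors and no letter
comes from the base group. -/
def Alternating (φ : ∀ i, H →* G i) (w : List (Σ i, G i)) : Prop :=
  w.IsChain (fun a b => a.1 ≠ b.1) ∧ ∀ a ∈ w, a.2 ∉ (φ a.1).range

/-- The element of the pushout spelled by a list of letters. -/
def listProd (φ : ∀ i, H →* G i) (w : List (Σ i, G i)) : PushoutI φ :=
  (w.map fun a => of a.1 a.2).prod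

@[simp] theorem listProd_nil : listProd φ [] = 1 := rfl

@[simp] theorem listProd_cons (a : Σ i, G i) (w : List (Σ i, G i)) :
    listProd φ (a :: w) = of a.1 a.2 * listProd φ w := by
  simp [listProd]

@[simp] theorem listProd_append (v w : List (Σ i, G i)) :
    listProd φ (v ++ w) = listProd φ v * listProd φ w := by
  simp [listProd]

theorem Alternating.listProd_ne_one (hφ : ∀ i, Function.Injective (φ i)) {w : List (Σ i, G i)}
    (hw : Alternating φ w) (hne : w ≠ []) : listProd φ w ≠ 1 := by
  intro h
  let v : CoprodI.Word G :=
    ⟨w, fun a ha h1 => hw.2 a ha (h1 ▸ one_mem _), hw.1⟩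
  have hv : Reduced φ v := hw.2
  have hprod : ofCoprodI v.prod = listProd φ w := by
    simp [v, CoprodI.Word.prod, listProd, map_list_prod, Function.comp_def]
  have := hv.eq_empty_of_mem_range hφ (by rw [hprod, h]; exact one_mem _)
  exact hne (congrArg CoprodI.Word.toList this)

theorem Alternating.tail {a : Σ i, G i} {w : List (Σ i, G i)} (hw : Alternating φ (a :: w)) :
    Alternating φ w :=
  ⟨hw.1.tail, fun b hb => hw.2 b (List.mem_cons_of_mem _ hb)⟩

theorem Alternating.replace_head {i : ι} {g g' : G i} {w : List (Σ i, G i)}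
    (hw : Alternating φ (⟨i, g⟩ :: w)) (hg' : g' ∉ (φ i).range) :
    Alternating φ (⟨i, g'⟩ :: w) := by
  refine ⟨?_, ?_⟩
  · have := hw.1
    rw [List.isChain_cons] at this ⊢
    exact this
  · intro b hb
    rcases List.mem_cons.1 hb with rfl | hb
    · exact hg'
    · exact hw.2 b (List.mem_cons_of_mem _ hb)

/-- A base element can be absorbed into the first letter of an alternating list. -/
theorem Alternating.exists_base_mul {w : List (Σ i, G i)} (hw : Alternating φ w) (hne : w ≠ [])
    (h : H) : ∃ v, Alternating φ v ∧ v.length = w.length ∧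
      listProd φ v = base φ h * listProd φ w := by
  obtain ⟨⟨i, g⟩, w, rfl⟩ := List.exists_cons_of_ne_nil hne
  refine ⟨⟨i, φ i h * g⟩ :: w, hw.replace_head ?_, rfl, ?_⟩
  · rw [Subgroup.mul_mem_cancel_left _ (MonoidHom.mem_range.2 ⟨h, rfl⟩)]
    exact hw.2 _ List.mem_cons_self
  · simp [of_apply_eq_base, mul_assoc]

/-- Every element of a pushout is in the base or is spelled by a nonempty alternating list. -/
theorem exists_base_or_alternating (x : PushoutI φ) :
    (∃ h, x = base φ h) ∨ ∃ w, w ≠ [] ∧ Alternating φ w ∧ x = listProd φ w := by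
  have absorb : ∀ (h : H) (w : List (Σ i, G i)), Alternating φ w →
      (∃ h', base φ h * listProd φ w = base φ h') ∨
        ∃ v, v ≠ [] ∧ Alternating φ v ∧ base φ h * listProd φ w = listProd φ v := by
    intro h w hw
    rcases eq_or_ne w [] with rfl | hne
    · exact .inl ⟨h, by simp⟩
    · obtain ⟨v, hv, hlen, hprod⟩ := hw.exists_base_mul hne h
      exact .inr ⟨v, List.length_pos_iff.1 (hlen ▸ List.length_pos_iff.2 hne), hv, hprod.symm⟩
  have of_mul : ∀ (i : ι) (g : G i) (w : List (Σ i, G i)), Alternating φ w →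
      (∃ h', of i g * listProd φ w = base φ h') ∨
        ∃ v, v ≠ [] ∧ Alternating φ v ∧ of i g * listProd φ w = listProd φ v := by
    intro i g w hw
    by_cases hg : g ∈ (φ i).range
    · obtain ⟨h, rfl⟩ := hg
      rw [of_apply_eq_base]
      exact absorb h w hw
    rcases w with _ | ⟨⟨j, a⟩, w⟩
    · exact .inr ⟨[⟨i, g⟩], by simp, ⟨by simp, by simpa using hg⟩, by simp⟩
    by_cases hij : i = j
    · subst hij
      rw [listProd_cons, ← mul_assoc, ← map_mul]
      by_cases hga : g * a ∈ (φ i).range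
      · obtain ⟨h, hh⟩ := hga
        rw [← hh, of_apply_eq_base]
        exact absorb h w hw.tail
      · exact .inr ⟨⟨i, g * a⟩ :: w, by simp, hw.replace_head hga, by simp⟩
    · refine .inr ⟨⟨i, g⟩ :: ⟨j, a⟩ :: w, by simp, ⟨hw.1.cons_cons hij, ?_⟩, by simp⟩
      intro b hb
      rcases List.mem_cons.1 hb with rfl | hb
      · exact hg
      · exact hw.2 b hb
  have key : ∀ y x : PushoutI φ,
      ((∃ h, x = base φ h) ∨ ∃ w, w ≠ [] ∧ Alternating φ w ∧ x = listProd φ w) →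
      ((∃ h, y * x = base φ h) ∨ ∃ w, w ≠ [] ∧ Alternating φ w ∧ y * x = listProd φ w) := by
    intro y
    induction y using induction_on with
    | of i g =>
      rintro x (⟨h, rfl⟩ | ⟨w, -, hw, rfl⟩)
      · have := of_mul i (g * φ i h) [] ⟨by simp, by simp⟩
        simpa [of_apply_eq_base] using this
      · exact of_mul i g w hw
    | base h' =>
      rintro x (⟨h, rfl⟩ | ⟨w, -, hw, rfl⟩)
      · exact .inl ⟨h' * h, by simp⟩
      · exact absorb h' w hw
    | mul a b ha hb =>
      intro x hx
      rw [mul_assoc]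
      exact ha _ (hb _ hx)
  simpa using key x 1 (.inl ⟨1, by simp⟩)

theorem Alternating.exists_pow {w : List (Σ i, G i)} (hw : Alternating φ w) (hne : w ≠ [])
    (hcyc : ∀ a ∈ w.getLast?, ∀ b ∈ w.head?, a.1 ≠ b.1) (n : ℕ) :
    ∃ v, Alternating φ v ∧ v ≠ [] ∧ v.head? = w.head? ∧
      listProd φ v = listProd φ w ^ (n + 1) := by
  induction n with
  | zero => exact ⟨w, hw, hne, rfl, by simp⟩
  | succ n ih =>
    obtain ⟨v, hv, hvne, hhead, hprod⟩ := ih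
    refine ⟨w ++ v, ⟨List.isChain_append.2 ⟨hw.1, hv.1, by rwa [hhead]⟩, ?_⟩, by simp [hne], ?_, ?_⟩
    · intro a ha
      rcases List.mem_append.1 ha with ha | ha
      exacts [hw.2 a ha, hv.2 a ha]
    · rw [List.head?_append_of_ne_nil _ hne]
    · rw [listProd_append, hprod, ← pow_succ']

/-- An alternating list spelling a torsion element spells a conjugate of a factor element. -/
theorem Alternating.exists_conj (hφ : ∀ i, Function.Injective (φ i)) {n : ℕ}
    (hn : n ≠ 0) (w : List (Σ i, G i)) (hw : Alternating φ w) (hne : w ≠ [])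
    (hpow : listProd φ w ^ n = 1) :
    ∃ (c : PushoutI φ) (i : ι) (g : G i), listProd φ w = c * of i g * c⁻¹ := by
  induction hlen : w.length using Nat.strong_induction_on generalizing w with
  | _ N ih =>
  subst hlen
  obtain ⟨⟨i, a⟩, u, rfl⟩ := List.exists_cons_of_ne_nil hne
  rcases List.eq_nil_or_concat u with rfl | ⟨mid, ⟨j, b⟩, rfl⟩
  · exact ⟨1, i, a, by simp⟩
  by_cases hij : j = i
  · subst hij
    have hmid : mid ≠ [] := by
      rintro rfl
      have := hw.1
      simp at this
    have hconj : listProd φ (⟨j, a⟩ :: (mid ++ [⟨j, b⟩])) =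
        (of j b)⁻¹ * (of j (b * a) * listProd φ mid) * ((of j b)⁻¹)⁻¹ := by
      simp [mul_assoc]
    have hmidpow : (of j (b * a) * listProd φ mid) ^ n = 1 := by
      have h2 := hpow
      simp only [List.concat_eq_append] at h2
      rwa [hconj, conj_pow, conj_eq_one_iff] at h2
    have hpre : Alternating φ (⟨j, a⟩ :: mid) := by
      refine ⟨?_, fun x hx => hw.2 x ?_⟩
      · have := hw.1
        rw [List.concat_eq_append, ← List.cons_append] at this
        exact (List.isChain_append.1 this).1
      · simp only [List.concat_eq_append, List.mem_cons, List.mem_append] at hx ⊢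
        tauto
    suffices ∃ (c : PushoutI φ) (i : ι) (g : G i),
        of j (b * a) * listProd φ mid = c * of i g * c⁻¹ by
      obtain ⟨c, i, g, h⟩ := this
      refine ⟨(of j b)⁻¹ * c, i, g, ?_⟩
      rw [List.concat_eq_append, hconj, h]
      group
    by_cases hba : b * a ∈ (φ j).range
    · obtain ⟨h, hh⟩ := hba
      rw [← hh, of_apply_eq_base] at hmidpow ⊢
      obtain ⟨v, hv, hlen, hprod⟩ := hpre.tail.exists_base_mul hmid h
      rw [← hprod] at hmidpow ⊢
      refine ih v.length ?_ v hv ?_ hmidpow rfl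
      · simp [hlen]
      · rintro rfl
        exact hmid (List.length_eq_zero_iff.1 hlen.symm)
    · have := ih _ ?_ (⟨j, b * a⟩ :: mid) (hpre.replace_head hba) (by simp)
        (by simpa using hmidpow) rfl
      · simpa using this
      · simp
  · exfalso
    obtain ⟨v, hv, hvne, -, hprod⟩ := hw.exists_pow hne (by
      rw [List.concat_eq_append, ← List.cons_append, List.getLast?_append]
      simpa using hij) (n - 1)
    rw [Nat.sub_add_cancel (Nat.pos_of_ne_zero hn), hpow] at hprod
    exact hv.listProd_ne_one hφ hvne hprod

/-- Torsion elements of an amalgamated product are conjugate into a factor. -/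
theorem exists_conj_of_pow_eq_one [Nonempty ι] (hφ : ∀ i, Function.Injective (φ i)) {n : ℕ}
    (hn : n ≠ 0) {x : PushoutI φ} (hx : x ^ n = 1) :
    ∃ (c : PushoutI φ) (i : ι) (g : G i), g ^ n = 1 ∧ x = c * of i g * c⁻¹ := by
  suffices ∃ (c : PushoutI φ) (i : ι) (g : G i), x = c * of i g * c⁻¹ by
    obtain ⟨c, i, g, rfl⟩ := this
    refine ⟨c, i, g, of_injective hφ i ?_, rfl⟩
    rwa [conj_pow, conj_eq_one_iff, ← map_pow, ← map_one (of i)] at hx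
  rcases exists_base_or_alternating x with ⟨h, rfl⟩ | ⟨w, hne, hw, rfl⟩
  · obtain ⟨i⟩ := ‹Nonempty ι›
    exact ⟨1, i, φ i h, by simp [of_apply_eq_base]⟩
  · exact hw.exists_conj hφ hn w hne hx

end Monoid.PushoutI

theorem Equiv.addRight_one_zpow_apply {R : Type*} [Ring R] (a : ℤ) (v : R) :
    ((Equiv.addRight (1 : R)) ^ a) v = v + a := by
  induction a using Int.induction_on generalizing v with
  | zero => simp
  | succ n ih => rw [zpow_add_one, Equiv.Perm.mul_apply, ih]; simp; abel
  | pred n ih =>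
    rw [zpow_sub_one, Equiv.Perm.mul_apply, ih, Equiv.Perm.inv_def, Equiv.addRight_symm]
    simp; abel

/-- There is a group with elements `z` of infinite order and `t` such that all the `z ^ a * t`
have order dividing `k`: a translation and a rotation of the complex plane. -/
theorem exists_translation_rotation {k : ℕ} (hk : 2 ≤ k) : ∃ z t : Equiv.Perm ℂ,
    (∀ a : ℤ, z ^ a = 1 → a = 0) ∧ ∀ a : ℤ, (z ^ a * t) ^ k = 1 := by
  have hprim := Complex.isPrimitiveRoot_exp k (by omega)
  set ζ := Complex.exp (2 * Real.pi * Complex.I / k)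
  have hζ0 : ζ ≠ 0 := Complex.exp_ne_zero _
  have hζ1 : 1 - ζ ≠ 0 := sub_ne_zero.2 (hprim.ne_one (by omega)).symm
  refine ⟨Equiv.addRight 1, Equiv.mulLeft₀ ζ hζ0, fun a ha => ?_, fun a => ?_⟩
  · have := DFunLike.congr_fun ha (0 : ℂ)
    rw [Equiv.addRight_one_zpow_apply] at this
    simpa using this
  · set f := (Equiv.addRight (1 : ℂ)) ^ a * Equiv.mulLeft₀ ζ hζ0 with hf
    have hfa : ∀ v, f v = ζ * v + a := fun v => by
      rw [hf, Equiv.Perm.mul_apply, Equiv.addRight_one_zpow_apply]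
      simp
    have hpow : ∀ (j : ℕ) (v : ℂ), (f ^ j) v = ζ ^ j * (v - a / (1 - ζ)) + a / (1 - ζ) := by
      intro j v
      induction j with
      | zero => simp
      | succ j ih =>
        rw [pow_succ', Equiv.Perm.mul_apply, ih, hfa]
        field_simp
        ring
    ext1 v
    rw [hpow, hprim.pow_eq_one]
    simp

/-- The two factors of the amalgamated product built in `exists_torsion_detecting_group`. -/
def RotationFactor : Bool → Type
  | true => Multiplicative ℤ
  | false => Equiv.Perm ℂ

instance : ∀ b, Group (RotationFactor b)
  | true => inferInstanceAs (Group (Multiplicative ℤ))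
  | false => inferInstanceAs (Group (Equiv.Perm ℂ))

/-- For `h` of finite order `d` in `Q` there is a group over `Q` whose torsion is killed in `Q`,
with a lift `y` of `h` and an element `t` such that all the `y ^ (d * a) * t` have order dividing
`k`: amalgamate `⟨y⟩` with a group of plane motions along `y ^ d = z`, `z` a translation. -/
theorem exists_torsion_detecting_group {Q : Type*} [Group Q] (h : Q) {d : ℕ} (hd : d ≠ 0)
    (hh : h ^ d = 1) {k : ℕ} (hk : 2 ≤ k) :
    ∃ (Γ : Type) (_ : Group Γ) (y t : Γ) (q : Γ →* Q), q y = h ∧ q t = 1 ∧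
      (∀ a : ℤ, (y ^ (d * a) * t) ^ k = 1) ∧
      ∀ (γ : Γ) (n : ℕ), n ≠ 0 → γ ^ n = 1 → q γ = 1 := by
  obtain ⟨z, t, hz, hzt⟩ := exists_translation_rotation hk
  let φ : ∀ b, Multiplicative ℤ →* RotationFactor b
    | true => (zpowersHom (Multiplicative ℤ) (Multiplicative.ofAdd (d : ℤ)) :)
    | false => (zpowersHom (Equiv.Perm ℂ) z :)
  have hφ : ∀ b, Function.Injective (φ b) := by
    rintro (_ | _)
    · refine (injective_iff_map_eq_one (zpowersHom (Equiv.Perm ℂ) z)).2 fun a ha => ?_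
      exact hz a.toAdd (by simpa using ha)
    · refine (injective_iff_map_eq_one
        (zpowersHom (Multiplicative ℤ) (Multiplicative.ofAdd (d : ℤ)))).2 fun a ha => ?_
      have h1 := congrArg Multiplicative.toAdd ha
      simp [hd] at h1
      exact h1
  let f : ∀ b, RotationFactor b →* Q
    | true => (zpowersHom Q h :)
    | false => (1 : Equiv.Perm ℂ →* Q)
  have hf : ∀ b, (f b).comp (φ b) = 1 := by
    rintro (_ | _)
    · rfl
    · ext
      change zpowersHom Q h (zpowersHom (Multiplicative ℤ) (Multiplicative.ofAdd (d : ℤ)) _) = 1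
      simp [hh]
  let q := Monoid.PushoutI.lift f 1 hf
  let y₀ : RotationFactor true := Multiplicative.ofAdd (1 : ℤ)
  let t₀ : RotationFactor false := t
  refine ⟨Monoid.PushoutI φ, inferInstance, Monoid.PushoutI.of true y₀,
    Monoid.PushoutI.of false t₀, q, ?_, ?_, fun a => ?_, fun γ n hn hγ => ?_⟩
  · rw [Monoid.PushoutI.lift_of]
    change zpowersHom Q h (Multiplicative.ofAdd 1) = h
    simp
  · rw [Monoid.PushoutI.lift_of]
    rfl
  · have h1 : y₀ ^ ((d : ℤ) * a) = φ true (Multiplicative.ofAdd a) := by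
      change (Multiplicative.ofAdd (1 : ℤ)) ^ ((d : ℤ) * a) =
        zpowersHom (Multiplicative ℤ) (Multiplicative.ofAdd (d : ℤ)) (Multiplicative.ofAdd a)
      rw [zpowersHom_apply]
      apply Multiplicative.toAdd.injective
      simp [mul_comm]
    have h2 : φ false (Multiplicative.ofAdd a) * t₀ = (z ^ a * t : Equiv.Perm ℂ) := by
      change zpowersHom (Equiv.Perm ℂ) z (Multiplicative.ofAdd a) * t = _
      simp
    rw [← map_zpow, h1, Monoid.PushoutI.of_apply_eq_base,
      ← Monoid.PushoutI.of_apply_eq_base φ false, ← map_mul, ← map_pow, h2]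
    exact (congrArg _ (hzt a)).trans (map_one _)
  · obtain ⟨c, b, g, hg, rfl⟩ := Monoid.PushoutI.exists_conj_of_pow_eq_one hφ hn hγ
    suffices f b g = 1 by simp [q, this]
    rcases b with _ | _
    · rfl
    · have key : ∀ g : Multiplicative ℤ, g ^ n = 1 → g = 1 := fun g => (pow_eq_one_iff_left hn).1
      have h2 := key g hg
      exact (congrArg (zpowersHom Q h) h2).trans (map_one _)

section Monomial

variable {Q Γ J : Type*} [Group Q] [Group Γ] [MulAction Q J]

/-- The permutation `(j, γ) ↦ (u • j, f j * γ)` of `J × Γ`. -/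
def monomialPerm (u : Q) (f : J → Γ) : Equiv.Perm (J × Γ) where
  toFun x := (u • x.1, f x.1 * x.2)
  invFun x := (u⁻¹ • x.1, (f (u⁻¹ • x.1))⁻¹ * x.2)
  left_inv x := by simp
  right_inv x := by simp

theorem monomialPerm_mul (u v : Q) (f g : J → Γ) :
    monomialPerm u f * monomialPerm v g = monomialPerm (u * v) fun j => f (v • j) * g j := by
  ext x <;> simp [monomialPerm, mul_smul, mul_assoc]

theorem monomialPerm_one : monomialPerm (1 : Q) (1 : J → Γ) = 1 := by
  ext x <;> simp [monomialPerm]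

theorem monomialPerm_inv (u : Q) (f : J → Γ) :
    (monomialPerm u f)⁻¹ = monomialPerm u⁻¹ fun j => (f (u⁻¹ • j))⁻¹ := by
  rw [inv_eq_iff_mul_eq_one, monomialPerm_mul, ← monomialPerm_one (Q := Q)]
  congr 1
  · simp
  · ext j
    simp

theorem monomialPerm_pow_of_smul_eq {u : Q} {j : J} (hj : u • j = j) (f : J → Γ) (n : ℕ) (γ : Γ) :
    (monomialPerm u f ^ n) (j, γ) = (j, f j ^ n * γ) := by
  induction n with
  | zero => simp
  | succ n ih =>
    rw [pow_succ', Equiv.Perm.mul_apply, ih]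
    simp [monomialPerm, hj, pow_succ', mul_assoc]

/-- Pairs of an element `u` of `Q` and a monomial permutation over `u`, with entries in `A`, for
which the map `(j, γ) ↦ σ j * q γ` to `Q` is equivariant. -/
def monomialSubgroup (σ : J → Q) (q : Γ →* Q) (A : Subgroup Γ) :
    Subgroup (Equiv.Perm (J × Γ) × Q) where
  carrier := {p | ∃ f : J → Γ, (∀ j, f j ∈ A) ∧ (∀ j, σ (p.2 • j) * q (f j) = p.2 * σ j) ∧
    p.1 = monomialPerm p.2 f}
  one_mem' := ⟨1, fun j => A.one_mem, by simp, monomialPerm_one.symm⟩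
  mul_mem' := by
    rintro ⟨p, u⟩ ⟨p', v⟩ ⟨f, hfA, hf, hp⟩ ⟨g, hgA, hg, hp'⟩
    dsimp only at *
    refine ⟨fun j => f (v • j) * g j, fun j => A.mul_mem (hfA _) (hgA _), fun j => ?_, ?_⟩
    · dsimp only [Prod.mk_mul_mk]
      rw [mul_smul, map_mul, ← mul_assoc, hf, mul_assoc, hg, mul_assoc]
    · rw [Prod.mk_mul_mk, ← monomialPerm_mul, hp, hp']
  inv_mem' := by
    rintro ⟨p, u⟩ ⟨f, hfA, hf, hp⟩
    dsimp only at *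
    refine ⟨fun j => (f (u⁻¹ • j))⁻¹, fun j => A.inv_mem (hfA _), fun j => ?_, ?_⟩
    · dsimp only [Prod.inv_mk]
      have := hf (u⁻¹ • j)
      rw [smul_inv_smul] at this
      rw [map_inv, mul_inv_eq_iff_eq_mul, mul_assoc, this, inv_mul_cancel_left]
    · rw [Prod.inv_mk, hp, monomialPerm_inv]

end Monomial

section Presentation

variable {m n k : ℕ} {r : Fin n → Word (Fin m)}

theorem rho_eq_map (i : Fin n) : rho r i = FreeGroup.map Sum.inl (FreeGroup.mk (r i)) := rfl

/-- The projection `P̄_t^k → P̄` killing `t`. -/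
def killT (m n k : ℕ) (r : Fin n → Word (Fin m)) :
    PresentedGroup (PtkRels m n k r) →* PresentedGroup (PRels m n r) :=
  PresentedGroup.toGroup (f := Sum.elim PresentedGroup.of fun _ => 1) <| by
    rintro _ (⟨i, rfl⟩ | rfl)
    · have h : FreeGroup.lift (Sum.elim PresentedGroup.of fun _ => 1) (rho r i) =
          (1 : PresentedGroup (PRels m n r)) := by
        rw [rho_eq_map, ← MonoidHom.comp_apply]
        have : (FreeGroup.lift (Sum.elim PresentedGroup.of fun _ : Unit => 1)).comp
            (FreeGroup.map Sum.inl) = PresentedGroup.mk (PRels m n r) := by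
          ext
          simp [PresentedGroup.of]
        rw [this]
        exact PresentedGroup.one_of_mem ⟨i, rfl⟩
      simp [h, tGen]
    · simp [tGen]

@[simp] theorem killT_inl (x : Fin m) :
    killT m n k r (PresentedGroup.of (Sum.inl x)) = PresentedGroup.of x := by
  simp [killT]

@[simp] theorem killT_inr : killT m n k r (PresentedGroup.of (Sum.inr ())) = 1 := by
  simp [killT]

theorem killT_surjective : Function.Surjective (killT m n k r) := by
  rw [← MonoidHom.range_eq_top, ← top_le_iff, ← PresentedGroup.closure_range_of,
    Subgroup.closure_le]
  rintro _ ⟨x, rfl⟩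
  exact ⟨PresentedGroup.of (Sum.inl x), killT_inl x⟩

/-- Torsion elements of `P̄_t^k` die in `P̄`. -/
theorem killT_eq_one_of_pow_eq_one (hk : 2 ≤ k) {g : PresentedGroup (PtkRels m n k r)} {N : ℕ}
    (hN : N ≠ 0) (hg : g ^ N = 1) : killT m n k r g = 1 := by
  set h := killT m n k r g with hh
  have hd : orderOf h ≠ 0 := by
    rw [orderOf_ne_zero_iff, isOfFinOrder_iff_pow_eq_one]
    exact ⟨N, Nat.pos_of_ne_zero hN, by rw [hh, ← map_pow, hg, map_one]⟩
  obtain ⟨Γ, _, y, t, q, hqy, hqt, hyt, htors⟩ :=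
    exists_torsion_detecting_group h hd (pow_orderOf_eq_one h) hk
  let Q := PresentedGroup (PRels m n r)
  let J := Q ⧸ Subgroup.zpowers h
  let σ : J → Q := Quotient.out
  have hσ : ∀ j : J, (QuotientGroup.mk (σ j) : J) = j := fun j => QuotientGroup.out_eq' j
  have hc : ∀ (x : Fin m) (j : J), ∃ c : ℤ,
      h ^ c = (σ ((PresentedGroup.of x : Q) • j))⁻¹ * (PresentedGroup.of x * σ j) := by
    intro x j
    apply Subgroup.mem_zpowers_iff.1
    rw [← QuotientGroup.eq, hσ, ← smul_eq_mul, ← MulAction.Quotient.coe_smul_out]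
  choose c hc using hc
  let X : Fin m → Equiv.Perm (J × Γ) × Q := fun x =>
    (monomialPerm (PresentedGroup.of x : Q) fun j => y ^ c x j, PresentedGroup.of x)
  let T : Equiv.Perm (J × Γ) × Q := (monomialPerm (1 : Q) fun _ => t, 1)
  have hX : ∀ x, X x ∈ monomialSubgroup σ q (Subgroup.zpowers y) := fun x =>
    ⟨_, fun j => ⟨c x j, rfl⟩, fun j => by simp [X, hqy, hc], rfl⟩
  have hT : T ∈ monomialSubgroup σ q ⊤ :=
    ⟨fun _ => t, fun j => Subgroup.mem_top _, fun j => by simp [T, hqt], rfl⟩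
  have hlift : ∀ w : FreeGroup (Fin m), (FreeGroup.lift X w).2 = PresentedGroup.mk _ w := by
    intro w
    have : (MonoidHom.snd _ _).comp (FreeGroup.lift X) = PresentedGroup.mk (PRels m n r) := by
      ext
      simp [X, PresentedGroup.of]
    exact DFunLike.congr_fun this w
  have hTpow : T ^ k = 1 := by
    refine Prod.ext (Equiv.ext fun ⟨j, γ⟩ => ?_) (by simp [T])
    have := hyt 0
    simp only [mul_zero, zpow_zero, one_mul] at this
    simp [T, monomialPerm_pow_of_smul_eq, this]
  have hrel : ∀ i, (FreeGroup.lift X (FreeGroup.mk (r i)) * T) ^ k = 1 := by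
    intro i
    have h2 : (FreeGroup.lift X (FreeGroup.mk (r i))).2 = 1 :=
      (hlift _).trans (PresentedGroup.one_of_mem ⟨i, rfl⟩)
    have hmem : FreeGroup.lift X (FreeGroup.mk (r i)) ∈
        monomialSubgroup σ q (Subgroup.zpowers y) :=
      FreeGroup.range_lift_le (Set.range_subset_iff.2 hX) ⟨_, rfl⟩
    obtain ⟨f, hfA, hf, hp⟩ := hmem
    rw [h2] at hf hp
    have hprod : FreeGroup.lift X (FreeGroup.mk (r i)) * T =
        (monomialPerm (1 : Q) fun j => f j * t, 1) := by
      refine Prod.ext ?_ (by rw [Prod.snd_mul, h2, one_mul])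
      rw [Prod.fst_mul, hp, monomialPerm_mul]
      simp
    rw [hprod]
    refine Prod.ext (Equiv.ext fun ⟨j, γ⟩ => ?_) (by simp)
    obtain ⟨a, ha⟩ := hfA j
    have h3 := hf j
    simp only [one_smul, one_mul, mul_eq_left] at h3
    simp only at ha
    rw [← ha, map_zpow, hqy, ← orderOf_dvd_iff_zpow_eq_one] at h3
    obtain ⟨b, rfl⟩ := h3
    have := hyt b
    rw [ha] at this
    simp [monomialPerm_pow_of_smul_eq, this]
  have hrels : ∀ w ∈ PtkRels m n k r, FreeGroup.lift (Sum.elim X fun _ => T) w = 1 := by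
    have hcomp : (FreeGroup.lift (Sum.elim X fun _ : Unit => T)).comp
        (FreeGroup.map Sum.inl) = FreeGroup.lift X := by
      ext1
      simp
    rintro _ (⟨i, rfl⟩ | rfl)
    · rw [map_pow, map_mul, rho_eq_map, ← MonoidHom.comp_apply, hcomp, tGen,
        FreeGroup.lift_apply_of]
      exact hrel i
    · simpa [tGen] using hTpow
  let Θ := PresentedGroup.toGroup hrels
  have hΘ : Θ g ∈ monomialSubgroup σ q ⊤ := by
    obtain ⟨w, rfl⟩ := PresentedGroup.mk_surjective _ g
    refine FreeGroup.range_lift_le (Set.range_subset_iff.2 ?_) ⟨w, rfl⟩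
    rintro (x | -)
    · obtain ⟨f, -, hf⟩ := hX x
      exact ⟨f, fun _ => Subgroup.mem_top _, hf⟩
    · exact hT
  have hsnd : (Θ g).2 = h := by
    have : (MonoidHom.snd _ _).comp Θ = killT m n k r := by
      ext (x | x)
      · refine Eq.trans ?_ (killT_inl x).symm
        simp [Θ, X]
      · refine Eq.trans ?_ killT_inr.symm
        simp [Θ, T]
    exact DFunLike.congr_fun this g
  obtain ⟨f, -, hf, hp⟩ := hΘ
  rw [hsnd] at hf hp
  let j₀ : J := QuotientGroup.mk 1
  have hj₀ : h • j₀ = j₀ := by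
    change (QuotientGroup.mk (h * 1) : J) = QuotientGroup.mk 1
    rw [QuotientGroup.eq, mul_one, mul_one]
    exact inv_mem (Subgroup.mem_zpowers h)
  obtain ⟨a, ha⟩ : ∃ a : ℤ, h ^ a = σ j₀ := by
    apply Subgroup.mem_zpowers_iff.1
    have := QuotientGroup.eq.1 (hσ j₀).symm
    simpa using this
  have hq : q (f j₀) = h := by
    have := hf j₀
    rw [hj₀, ← ha, ← zpow_one_add, add_comm, zpow_add_one] at this
    exact mul_left_cancel this
  have hpow : f j₀ ^ N = 1 := by
    have h1 : (Θ g).1 ^ N = 1 := by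
      rw [← Prod.pow_fst, ← map_pow, hg, map_one, Prod.fst_one]
    rw [hp] at h1
    have h2 := monomialPerm_pow_of_smul_eq hj₀ f N 1
    rw [h1] at h2
    simpa using (congrArg Prod.snd h2).symm
  rw [← hq]
  exact htors _ N hN hpow

/-- `P̄` is the quotient of `P̄_t^k` by the normal closure of its torsion. -/
theorem ker_killT (hk : 2 ≤ k) :
    (killT m n k r).ker = tor (PresentedGroup (PtkRels m n k r)) 1 := by
  apply le_antisymm
  · have tor_normal : (tor (PresentedGroup (PtkRels m n k r)) 1).Normal :=
      Subgroup.normalClosure_normal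
    let π := QuotientGroup.mk' (tor (PresentedGroup (PtkRels m n k r)) 1)
    have hπ : ∀ g : PresentedGroup (PtkRels m n k r), g ^ k = 1 → π g = 1 := fun g hg =>
      (QuotientGroup.eq_one_iff g).2 <|
        Subgroup.subset_normalClosure ⟨k, by omega, by rw [hg]; exact one_mem _⟩
    have ht : π (PresentedGroup.mk _ (tGen m)) = 1 := by
      apply hπ
      rw [← map_pow]
      exact PresentedGroup.one_of_mem (.inr rfl)
    have hrho : ∀ i, π (PresentedGroup.mk _ (rho r i)) = 1 := by
      intro i
      have : π (PresentedGroup.mk _ (rho r i * tGen m)) = 1 := by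
        apply hπ
        rw [← map_pow]
        exact PresentedGroup.one_of_mem (.inl ⟨i, rfl⟩)
      rwa [map_mul, map_mul, ht, mul_one] at this
    have hrels : ∀ w ∈ PRels m n r,
        FreeGroup.lift (fun x : Fin m =>
          π (PresentedGroup.of (rels := PtkRels m n k r) (Sum.inl x))) w = 1 := by
      rintro _ ⟨i, rfl⟩
      have : FreeGroup.lift (fun x : Fin m =>
          π (PresentedGroup.of (rels := PtkRels m n k r) (Sum.inl x))) =
          (π.comp (PresentedGroup.mk _)).comp (FreeGroup.map Sum.inl) := by
        ext
        simp [PresentedGroup.of]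
      rw [← hrho i, this]
      rfl
    have hcomp : (PresentedGroup.toGroup hrels).comp (killT m n k r) = π := by
      ext (x | x)
      · simp
      · rw [MonoidHom.comp_apply, killT_inr, map_one]
        exact ht.symm
    intro g hg
    rw [← QuotientGroup.eq_one_iff]
    change π g = 1
    rw [← hcomp, MonoidHom.comp_apply, MonoidHom.mem_ker.1 hg, map_one]
  · refine Subgroup.normalClosure_le_normal ?_
    rintro g ⟨N, hN, hg⟩
    exact killT_eq_one_of_pow_eq_one hk hN.ne' (Subgroup.mem_bot.1 hg)

theorem tor_one_ne_bot (hk : 2 ≤ k) : tor (PresentedGroup (PtkRels m n k r)) 1 ≠ ⊥ := by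
  have hrels : ∀ w ∈ PtkRels m n k r,
      FreeGroup.lift (Sum.elim (fun _ : Fin m => (1 : Multiplicative (ZMod k)))
        fun _ => Multiplicative.ofAdd 1) w = 1 := by
    have ht : (Multiplicative.ofAdd (1 : ZMod k)) ^ k = 1 := by
      rw [← ofAdd_nsmul]
      simp
    rintro _ (⟨i, rfl⟩ | rfl)
    · have hcomp : (FreeGroup.lift (Sum.elim (fun _ : Fin m => (1 : Multiplicative (ZMod k)))
          fun _ : Unit => Multiplicative.ofAdd 1)).comp (FreeGroup.map Sum.inl) = 1 := by
        ext
        simp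
      rw [map_pow, map_mul, rho_eq_map, ← MonoidHom.comp_apply, hcomp]
      simpa [tGen] using ht
    · simpa [tGen] using ht
  intro h
  have hmem : PresentedGroup.of (Sum.inr ()) ∈ tor (PresentedGroup (PtkRels m n k r)) 1 := by
    rw [← ker_killT hk, MonoidHom.mem_ker, killT_inr]
  rw [h, Subgroup.mem_bot] at hmem
  have h1 := congrArg (PresentedGroup.toGroup hrels) hmem
  have : Fact (1 < k) := ⟨by omega⟩
  simp at h1

end Presentation

/-- The torsion chain pulls back along a surjection with kernel the first term of the chain. -/
theorem tor_succ_eq_comap {G Q : Type*} [Group G] [Group Q] {f : G →* Q}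
    (hf : Function.Surjective f) (hker : f.ker = tor G 1) (j : ℕ) :
    tor G (j + 1) = (tor Q j).comap f := by
  induction j with
  | zero => rw [zero_add, ← hker]; rfl
  | succ j ih =>
    have hset : {g : G | ∃ k : ℕ, 0 < k ∧ g ^ k ∈ tor G (j + 1)} =
        f ⁻¹' {x : Q | ∃ k : ℕ, 0 < k ∧ x ^ k ∈ tor Q j} := by
      ext g
      simp [ih]
    have hmap : (tor G (j + 2)).map f = tor Q (j + 1) := by
      change (Subgroup.normalClosure {g : G | ∃ k : ℕ, 0 < k ∧ g ^ k ∈ tor G (j + 1)}).map f =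
        Subgroup.normalClosure _
      rw [Subgroup.map_normalClosure _ _ hf, hset, Set.image_preimage_eq _ hf]
    rw [← hmap, Subgroup.comap_map_eq_self]
    intro g hg
    refine Subgroup.subset_normalClosure ⟨1, one_pos, ?_⟩
    rw [pow_one, ih, Subgroup.mem_comap, MonoidHom.mem_ker.1 hg]
    exact one_mem _

/-- Theorem: for `P = ⟨x₁,…,x_m | r₁,…,rₙ⟩` with all relators freely reduced, cyclically
reduced and distinct, and `k ≥ 12`, the group presented by
`P_t^k = ⟨x₁,…,x_m,t | (r₁t)^k,…,(rₙt)^k, t^k⟩` has `torlen(P̄_t^k) = torlen(P̄) + 1`: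
its `tor₁` is nontrivial, and its torsion chain stabilises at step `m + 1` exactly when
that of `P̄` stabilises at step `m`. -/
theorem ptk_torlen_succ {m n k : ℕ} (hk : 12 ≤ k) (r : Fin n → Word (Fin m))
    (hred : ∀ i, Reduced (r i)) (hcyc : ∀ i, CyclicallyReduced (r i))
    (hdist : Function.Injective r) :
    tor (PresentedGroup (PtkRels m n k r)) 1 ≠ ⊥ ∧
      ∀ j : ℕ,
        (tor (PresentedGroup (PtkRels m n k r)) (j + 1) =
            tor (PresentedGroup (PtkRels m n k r)) (j + 2) ↔
          tor (PresentedGroup (PRels m n r)) j =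
            tor (PresentedGroup (PRels m n r)) (j + 1)) := by
  refine ⟨tor_one_ne_bot (by omega), fun j => ?_⟩
  have h := tor_succ_eq_comap killT_surjective (ker_killT (r := r) (show 2 ≤ k by omega))
  rw [h, h]
  exact (Subgroup.comap_injective killT_surjective).eq_iff
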